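/- Let G be the free group on four generators w, x, y, z, and let s and t be the automorphisms of G determined by: s fixes w, x and z and sends y to x y⁻¹ z; t fixes w, y and z and sends x to w x⁻¹ y. Then s ∘ t ∘ s = t ∘ s ∘ t. -/

import Mathlib

/-- Let `G` be the free group on four generators `w, x, y, z`
(indexed `0, 1, 2, 3`), and let `s, t` be the automorphisms of `G` with: `s` fixes
`w, x, z` and sends `y ↦ x y⁻¹ z`; `t` fixes `w, y, z` and sends `x ↦ w x⁻¹ y`.
Then `s ∘ t ∘ s = t ∘ s ∘ t`. -/
theorem statement16 (s t : MulAut (FreeGroup (Fin 4)))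
    (hsw : s (FreeGroup.of 0) = FreeGroup.of 0)
    (hsx : s (FreeGroup.of 1) = FreeGroup.of 1)
    (hsy : s (FreeGroup.of 2) = FreeGroup.of 1 * (FreeGroup.of 2)⁻¹ * FreeGroup.of 3)
    (hsz : s (FreeGroup.of 3) = FreeGroup.of 3)
    (htw : t (FreeGroup.of 0) = FreeGroup.of 0)
    (htx : t (FreeGroup.of 1) = FreeGroup.of 0 * (FreeGroup.of 1)⁻¹ * FreeGroup.of 2)
    (hty : t (FreeGroup.of 2) = FreeGroup.of 2)
    (htz : t (FreeGroup.of 3) = FreeGroup.of 3) :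
    s * t * s = t * s * t := by
  have h : (s * t * s).toMonoidHom = (t * s * t).toMonoidHom := by
    ext i
    fin_cases i <;>
      simp [MulAut.mul_apply, hsw, hsx, hsy, hsz, htw, htx, hty, htz, mul_assoc]
  exact MulEquiv.toMonoidHom_injective h
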